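/- The Green's function estimate for the GJMS operator: for n > 2k ≥ 2 and ρ > 0, P_k^{-1}(ρ) ≤ (1/γ_n(2k)) [ (1/(2 sinh(ρ/2)))^{n-2k} - (1/(2 cosh(ρ/2)))^{n-2k} ], where P_k^{-1}(ρ) = (Γ(n/2)/(2ⁿ π^{n/2} Γ(k) Γ(k+1))) (cosh(ρ/2))^{-n} (sinh(ρ/2))^{-(n-2k)} F(k-(n-2)/2, k; k+1; cosh^{-2}(ρ/2)), with F the Gauss hypergeometric function and γ_n(2k) = π^{n/2} 2^{2k} Γ(k) / Γ(n/2 - k). -/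

import Mathlib

open MeasureTheory

/-- The Gauss hypergeometric function `F(a,b;c;z) = Σ (a)_m (b)_m / ((c)_m m!) z^m`. -/
noncomputable def gaussF (a b c z : ℝ) : ℝ :=
  ∑' m : ℕ, ((ascPochhammer ℝ m).eval a * (ascPochhammer ℝ m).eval b) /
    ((ascPochhammer ℝ m).eval c * (m.factorial : ℝ)) * z ^ m

theorem hasSum_ascPochhammer_div_factorial_mul_pow (a : ℝ) {z : ℝ} (hz : |z| < 1) :
    HasSum (fun m : ℕ => (ascPochhammer ℝ m).eval a / (m.factorial : ℝ) * z ^ m)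
      ((1 - z) ^ (-a)) := by
  have h := (Real.one_div_one_sub_rpow_hasFPowerSeriesOnBall_zero a).hasSum (y := z)
    (by simpa [← ENNReal.ofReal_one, Metric.eball_ofReal] using hz)
  have h1 : 0 ≤ 1 - z := by linarith [(abs_lt.mp hz).2]
  simp only [zero_add, one_div, ← Real.rpow_neg h1] at h
  refine h.congr_fun fun m => ?_
  have h2 := Ring.factorial_nsmul_multichoose_eq_ascPochhammer a m
  rw [Ring.multichoose_eq, Polynomial.ascPochhammer_smeval_eq_eval] at h2
  have h3 : (m.factorial : ℝ) ≠ 0 := by positivity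
  simp only [FormalMultilinearSeries.ofScalars_apply_eq, smul_eq_mul]
  rw [← h2, nsmul_eq_mul, mul_div_cancel_left₀ _ h3]

theorem ascPochhammer_eval_mul_add_eq (b : ℝ) (m : ℕ) :
    (ascPochhammer ℝ m).eval b * (b + m) = b * (ascPochhammer ℝ m).eval (b + 1) := by
  rw [← ascPochhammer_succ_eval, ascPochhammer_succ_left]
  simp

/-- `gaussF a b (b + 1)` is `b` times the series `Σ (a)_m / m! z^m / (b + m)`. -/
theorem hasSum_gaussF_add_one (a : ℝ) {b z : ℝ} (hb : 1 ≤ b) (hz : |z| < 1) :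
    HasSum (fun m : ℕ => (ascPochhammer ℝ m).eval a / (m.factorial : ℝ) * z ^ m * (b / (b + m)))
      (gaussF a b (b + 1) z) := by
  have hs : Summable (fun m : ℕ =>
      (ascPochhammer ℝ m).eval a / (m.factorial : ℝ) * z ^ m * (b / (b + m))) := by
    refine (hasSum_ascPochhammer_div_factorial_mul_pow a hz).summable.abs.of_norm_bounded ?_
    intro m
    have h0 : (0 : ℝ) ≤ m := m.cast_nonneg
    rw [norm_mul, Real.norm_eq_abs, Real.norm_of_nonneg (by positivity)]
    refine mul_le_of_le_one_right (abs_nonneg _) ?_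
    rw [div_le_one (by positivity)]
    linarith
  convert hs.hasSum using 1
  unfold gaussF
  congr 1
  ext m
  have h0 : (0 : ℝ) ≤ m := m.cast_nonneg
  have h1 := ascPochhammer_eval_mul_add_eq b m
  have h2 : (ascPochhammer ℝ m).eval (b + 1) ≠ 0 := (ascPochhammer_pos m _ (by linarith)).ne'
  have h3 : b + m ≠ 0 := by positivity
  have h4 : (ascPochhammer ℝ m).eval b / (ascPochhammer ℝ m).eval (b + 1) = b / (b + m) := by
    rw [div_eq_div_iff h2 h3, h1]
  rw [← h4]
  ring

theorem ascPochhammer_eval_neg_succ (s : ℝ) (m : ℕ) :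
    (ascPochhammer ℝ (m + 1)).eval (-s) = -s * (ascPochhammer ℝ m).eval (1 - s) := by
  rw [ascPochhammer_succ_left]
  simp [neg_add_eq_sub]

/-- Contiguity relation lowering the parameter `b` of `gaussF (1 - s) b (b + 1)`. -/
theorem gaussF_contiguous (s : ℝ) {b z : ℝ} (hb : 1 ≤ b) (hz : |z| < 1) :
    gaussF (1 - s) b (b + 1) z - (s + b) / (b + 1) * z * gaussF (1 - s) (b + 1) (b + 1 + 1) z =
      (1 - z) ^ s := by
  have h1 := hasSum_gaussF_add_one (1 - s) hb hz
  have h2 := hasSum_gaussF_add_one (1 - s) (b := b + 1) (by linarith) hz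
  have h3 := hasSum_ascPochhammer_div_factorial_mul_pow (-s) hz
  rw [neg_neg] at h3
  have h1' := (hasSum_nat_add_iff' 1).mpr h1
  have h3' := (hasSum_nat_add_iff' 1).mpr h3
  have hb0 : b ≠ 0 := by linarith
  simp only [Finset.sum_range_one, ascPochhammer_zero, Polynomial.eval_one, Nat.factorial_zero,
    Nat.cast_one, div_one, pow_zero, mul_one, Nat.cast_zero, add_zero,
    div_self hb0] at h1' h3'
  have h4 := h1'.sub (h2.mul_left ((s + b) / (b + 1) * z))
  have h5 := h4.unique (h3'.congr_fun ?_)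
  · linarith
  · intro m
    have h0 : (0 : ℝ) ≤ m := m.cast_nonneg
    have hm : (m.factorial : ℝ) ≠ 0 := by positivity
    have hm1 : (m : ℝ) + 1 ≠ 0 := by positivity
    have hm2 : b + 1 + m ≠ 0 := by positivity
    have hm3 : b + (m + 1) ≠ 0 := by positivity
    have hm4 : b + 1 ≠ 0 := by positivity
    rw [ascPochhammer_eval_neg_succ, ascPochhammer_succ_eval, Nat.factorial_succ]
    push_cast
    field_simp
    ring

theorem mul_gaussF_two (s : ℝ) {z : ℝ} (hz : |z| < 1) :
    s * z * gaussF (1 - s) 1 (1 + 1) z = 1 - (1 - z) ^ s := by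
  have h2 := hasSum_gaussF_add_one (1 - s) le_rfl hz
  have h3 := hasSum_ascPochhammer_div_factorial_mul_pow (-s) hz
  rw [neg_neg] at h3
  have h3' := ((hasSum_nat_add_iff' 1).mpr h3).neg
  simp only [Finset.sum_range_one, ascPochhammer_zero, Polynomial.eval_one, Nat.factorial_zero,
    Nat.cast_one, div_one, pow_zero, mul_one, neg_sub] at h3'
  refine (h2.mul_left (s * z)).unique (h3'.congr_fun ?_)
  intro m
  have hm : (m.factorial : ℝ) ≠ 0 := by positivity
  have hm1 : 1 + (m : ℝ) ≠ 0 := by positivity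
  rw [ascPochhammer_eval_neg_succ, Nat.factorial_succ]
  push_cast
  field_simp
  ring

/-- The regularised incomplete beta function `I_z(k, s)`, written as a hypergeometric function,
is at most `I_z(1, s) = 1 - (1 - z) ^ s`. -/
theorem Gamma_mul_pow_mul_gaussF_le {s z : ℝ} (hs : 0 < s) (hz0 : 0 ≤ z) (hz1 : z < 1) (k : ℕ) :
    Real.Gamma (s + (k + 1 : ℕ)) / (Real.Gamma ((k + 1 : ℕ) + 1) * Real.Gamma s) * z ^ (k + 1) *
      gaussF (1 - s) (k + 1 : ℕ) ((k + 1 : ℕ) + 1) z ≤ 1 - (1 - z) ^ s := by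
  have hz : |z| < 1 := by rwa [abs_of_nonneg hz0]
  have hG : 0 < Real.Gamma s := Real.Gamma_pos_of_pos hs
  induction k with
  | zero =>
    rw [← mul_gaussF_two s hz]
    simp [Real.Gamma_add_one hs.ne', Real.Gamma_add_one, hG.ne']
  | succ k ih =>
    refine le_trans ?_ ih
    have hb : (1 : ℝ) ≤ (k + 1 : ℕ) := by simp
    have hc := gaussF_contiguous s hb hz
    have e : ((k + 1 + 1 : ℕ) : ℝ) = ((k + 1 : ℕ) : ℝ) + 1 := by push_cast; ring
    rw [e]
    generalize ((k + 1 : ℕ) : ℝ) = b at *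
    have h1 : Real.Gamma (s + (b + 1)) = (s + b) * Real.Gamma (s + b) := by
      rw [← add_assoc, Real.Gamma_add_one (by positivity)]
    have h2 : Real.Gamma (b + 1 + 1) = (b + 1) * Real.Gamma (b + 1) :=
      Real.Gamma_add_one (by positivity)
    have hGb : 0 < Real.Gamma (b + 1) := Real.Gamma_pos_of_pos (by positivity)
    have hGs : 0 < Real.Gamma (s + b) := Real.Gamma_pos_of_pos (by positivity)
    have h3 : (0 : ℝ) ≤ (1 - z) ^ s := Real.rpow_nonneg (by linarith) _
    have h4 : 0 ≤ Real.Gamma (s + b) / (Real.Gamma (b + 1) * Real.Gamma s) * z ^ (k + 1) *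
        (1 - z) ^ s := by positivity
    rw [← hc, mul_sub, sub_nonneg] at h4
    refine le_of_eq_of_le ?_ h4
    rw [h1, h2, pow_succ z (k + 1)]
    field_simp

/-- the Green's function estimate
`P_k^{-1}(ρ) ≤ (1/γ_n(2k)) [(1/(2 sinh(ρ/2)))^{n-2k} - (1/(2 cosh(ρ/2)))^{n-2k}]` where
`P_k^{-1}(ρ) = (Γ(n/2)/(2ⁿ π^{n/2} Γ(k)Γ(k+1))) (cosh(ρ/2))^{-n} (sinh(ρ/2))^{-(n-2k)}
F(k-(n-2)/2, k; k+1; cosh⁻²(ρ/2))` and `γ_n(2k) = π^{n/2} 2^{2k} Γ(k)/Γ(n/2-k)`. -/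
theorem stmt_9 (n k : ℕ) (hk : 1 ≤ k) (hn : 2 * k < n) (ρ : ℝ) (hρ : 0 < ρ) :
    (Real.Gamma ((n : ℝ) / 2) /
        (2 ^ (n : ℝ) * Real.pi ^ ((n : ℝ) / 2) * Real.Gamma (k : ℝ) * Real.Gamma ((k : ℝ) + 1))) *
        (Real.cosh (ρ / 2)) ^ (-(n : ℝ)) * (Real.sinh (ρ / 2)) ^ (-((n : ℝ) - 2 * k)) *
        gaussF ((k : ℝ) - ((n : ℝ) - 2) / 2) (k : ℝ) ((k : ℝ) + 1)
          ((Real.cosh (ρ / 2)) ^ (-(2 : ℝ)))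
      ≤ (1 / (Real.pi ^ ((n : ℝ) / 2) * 2 ^ (2 * (k : ℝ)) * Real.Gamma (k : ℝ) /
            Real.Gamma ((n : ℝ) / 2 - k))) *
          ((1 / (2 * Real.sinh (ρ / 2))) ^ ((n : ℝ) - 2 * k) -
            (1 / (2 * Real.cosh (ρ / 2))) ^ ((n : ℝ) - 2 * k)) := by
  obtain ⟨j, rfl⟩ : ∃ j, k = j + 1 := ⟨k - 1, by omega⟩
  have hn' : 2 * ((j + 1 : ℕ) : ℝ) < n := by exact_mod_cast hn
  have key := fun s z hs hz0 hz1 => Gamma_mul_pow_mul_gaussF_le (s := s) (z := z) hs hz0 hz1 j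
  have hb : (0 : ℝ) < (j + 1 : ℕ) := by positivity
  have hzpow : ∀ z : ℝ, z ^ (j + 1) = z ^ ((j + 1 : ℕ) : ℝ) := fun z => (Real.rpow_natCast _ _).symm
  simp only [hzpow] at key
  generalize ((j + 1 : ℕ) : ℝ) = b at *
  obtain ⟨s, hs⟩ : ∃ s, s = (n : ℝ) / 2 - b := ⟨_, rfl⟩
  obtain hnN : (n : ℝ) = 2 * (s + b) := by linarith
  have hs0 : 0 < s := by linarith
  rw [hnN]
  have hC : 0 < Real.cosh (ρ / 2) := Real.cosh_pos _
  have hC1 : 1 < Real.cosh (ρ / 2) := Real.one_lt_cosh.mpr (by positivity)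
  have hS : 0 < Real.sinh (ρ / 2) := Real.sinh_pos_iff.mpr (by positivity)
  have hCS := Real.cosh_sq (ρ / 2)
  generalize Real.cosh (ρ / 2) = C at *
  generalize Real.sinh (ρ / 2) = S at *
  have e1 : b - (2 * (s + b) - 2) / 2 = 1 - s := by ring
  have e2 : 2 * (s + b) / 2 = s + b := by ring
  have e3 : s + b - b = s := by ring
  have e4 : 2 * (s + b) - 2 * b = 2 * s := by ring
  rw [e1, e2, e3, e4]
  have hz1 : C ^ (-(2 : ℝ)) < 1 := Real.rpow_lt_one_of_one_lt_of_neg hC1 (by norm_num)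
  have hz0 : 0 ≤ C ^ (-(2 : ℝ)) := by positivity
  have hk := key s _ hs0 hz0 hz1
  have h1z : (1 - C ^ (-(2 : ℝ))) ^ s = S ^ (2 * s) * C ^ (-(2 * s)) := by
    have : 1 - C ^ (-(2 : ℝ)) = S ^ (2 : ℝ) * C ^ (-(2 : ℝ)) := by
      rw [Real.rpow_neg hC.le, Real.rpow_two, Real.rpow_two]
      field_simp
      linarith
    rw [this, Real.mul_rpow (by positivity) (by positivity), ← Real.rpow_mul hS.le,
      ← Real.rpow_mul hC.le, neg_mul]
  have hCs : C ^ (-(2 * s)) ≤ 1 :=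
    (Real.rpow_lt_one_of_one_lt_of_neg hC1 (by linarith)).le
  have hR : 0 ≤ 1 - (1 - C ^ (-(2 : ℝ))) ^ s :=
    sub_nonneg.mpr (Real.rpow_le_one (by linarith) (by linarith) hs0.le)
  have hk' := (mul_le_mul_of_nonneg_left hk (Real.rpow_nonneg hC.le (-(2 * s)))).trans
    (mul_le_of_le_one_left hR hCs)
  rw [h1z, ← Real.rpow_mul hC.le] at hk'
  have hC2 : C ^ (-(2 * (s + b))) = C ^ (-(2 * s)) * C ^ (-2 * b) := by
    rw [← Real.rpow_add hC]; ring_nf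
  have h2 : (2 : ℝ) ^ (2 * (s + b)) = 2 ^ (2 * s) * 2 ^ (2 * b) := by
    rw [← Real.rpow_add two_pos]; ring_nf
  have hSi : (1 / (2 * S)) ^ (2 * s) = (2 ^ (2 * s))⁻¹ * S ^ (-(2 * s)) := by
    rw [one_div, Real.inv_rpow (by positivity), Real.mul_rpow two_pos.le hS.le, mul_inv,
      Real.rpow_neg hS.le]
  have hCi : (1 / (2 * C)) ^ (2 * s) = (2 ^ (2 * s))⁻¹ * C ^ (-(2 * s)) := by
    rw [one_div, Real.inv_rpow (by positivity), Real.mul_rpow two_pos.le hC.le, mul_inv,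
      Real.rpow_neg hC.le]
  have hSS : S ^ (2 * s) * S ^ (-(2 * s)) = 1 := by
    rw [← Real.rpow_add hS, add_neg_cancel, Real.rpow_zero]
  have hGs : 0 < Real.Gamma s := Real.Gamma_pos_of_pos hs0
  have hGb : 0 < Real.Gamma b := Real.Gamma_pos_of_pos hb
  have hGb1 : 0 < Real.Gamma (b + 1) := Real.Gamma_pos_of_pos (by positivity)
  have hD : 0 ≤ Real.Gamma s / (2 ^ (2 * s) * 2 ^ (2 * b) * Real.pi ^ (s + b) * Real.Gamma b) *
      S ^ (-(2 * s)) := by positivity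
  have hfin := mul_le_mul_of_nonneg_left hk' hD
  rw [hC2, h2, hSi, hCi]
  have hpi : 0 < Real.pi ^ (s + b) := by positivity
  have h2s : (0 : ℝ) < 2 ^ (2 * s) := by positivity
  have h2b : (0 : ℝ) < 2 ^ (2 * b) := by positivity
  generalize gaussF (1 - s) b (b + 1) (C ^ (-(2 : ℝ))) = F at *
  generalize S ^ (-(2 * s)) = T at *
  generalize S ^ (2 * s) = T' at *
  generalize C ^ (-(2 * s)) = U at *
  generalize C ^ (-2 * b) = V at *
  generalize (2 : ℝ) ^ (2 * s) = p at *
  generalize (2 : ℝ) ^ (2 * b) = q at *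
  generalize Real.pi ^ (s + b) = r at *
  generalize Real.Gamma (s + b) = G at *
  generalize Real.Gamma s = Gs at *
  generalize Real.Gamma (b + 1) = Gb1 at *
  generalize Real.Gamma b = Gb at *
  calc _ = Gs / (p * q * r * Gb) * T * (U * (G / (Gb1 * Gs) * V * F)) := by field_simp
    _ ≤ _ := hfin
    _ = Gs / (p * q * r * Gb) * (T - T' * T * U) := by ring
    _ = _ := by rw [hSS, one_mul]; field_simp
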